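/- Define Λ(ξ) := ξ₃/‖ξ‖ for ξ ≠ 0, write ξ_h := (ξ₁,ξ₂,0), v^⊥ := (−v₂,v₁,0) for the horizontal rotation by 90 degrees, and σ̄(ξ,η) := ξ₃·η_h − η₃·ξ_h. Let ξ, η ∈ ℝ³ with ξ ≠ η. Then the directional derivative of η' ↦ Λ(ξ−η') at η in the direction η_h^⊥ = (−η₂,η₁,0) (the action of the rotation vector field Ω_η) equals −σ̄(ξ,η)·(ξ_h−η_h)^⊥/‖ξ−η‖³, and moreover this quantity also equals Λ(ξ−η)·(η₁ξ₂−η₂ξ₁)/‖ξ−η‖². -/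

import Mathlib

open MeasureTheory RealInnerProductSpace

noncomputable section

/-- Euclidean 3-space. -/
abbrev E3 : Type := EuclideanSpace ℝ (Fin 3)

/-- The vector `(a, b, c) ∈ ℝ³`. -/
def Ev3 (a b c : ℝ) : E3 := (WithLp.equiv 2 (Fin 3 → ℝ)).symm ![a, b, c]

/-- Horizontal part `v_h = (v₁, v₂, 0)` of a vector `v ∈ ℝ³`. -/
def hpart (v : E3) : E3 := Ev3 (v 0) (v 1) 0

/-- Horizontal rotation by 90 degrees: `v_h^⊥ = (−v₂, v₁, 0)`. -/
def hperp (v : E3) : E3 := Ev3 (-(v 1)) (v 0) 0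

/-- The quantity `σ̄(ξ,η) := ξ₃ η_h − η₃ ξ_h`. -/
def sigmaBar (ξ η : E3) : E3 := (ξ 2) • hpart η - (η 2) • hpart ξ

/-- The dispersion relation `Λ(ξ) = ξ₃ / ‖ξ‖`. -/
def Lam (ξ : E3) : ℝ := ξ 2 / ‖ξ‖

/-- `s(ξ) := √(1 − Λ(ξ)²)`. -/
def sfun (ξ : E3) : ℝ := Real.sqrt (1 - Lam ξ ^ 2)

/-- The vertical unit vector `e₃`. -/
def e₃ : E3 := Ev3 0 0 1

/-- The direction `w(ξ) = (Λ(ξ)/s(ξ)) ξ_h − ‖ξ‖ s(ξ) e₃` of the vector field `Υ = ∂_φ`. -/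
def wvec (ξ : E3) : E3 := (Lam ξ / sfun ξ) • hpart ξ - (‖ξ‖ * sfun ξ) • e₃

/-- The norm of a real inner product space is differentiable away from the origin. -/
lemma hasFDerivAt_norm_of_ne_zero {E : Type*} [NormedAddCommGroup E] [InnerProductSpace ℝ E]
    {x : E} (hx : x ≠ 0) :
    HasFDerivAt (fun y : E => ‖y‖) (‖x‖⁻¹ • innerSL ℝ x) x := by
  have hsq : HasFDerivAt (fun y : E => ‖y‖ ^ 2) (2 • innerSL ℝ x) x :=
    (hasStrictFDerivAt_norm_sq x).hasFDerivAt
  have hn : ‖x‖ ≠ 0 := norm_ne_zero_iff.mpr hx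
  have hsqrt := hsq.sqrt (pow_ne_zero 2 hn)
  simp only [Real.sqrt_sq (norm_nonneg _)] at hsqrt
  convert hsqrt using 1
  ext v
  simp
  field_simp

/-- The derivative of `Λ` away from the origin. -/
lemma hasFDerivAt_Lam {z : E3} (hz : z ≠ 0) :
    HasFDerivAt Lam
      (‖z‖⁻¹ • EuclideanSpace.proj (𝕜 := ℝ) (2 : Fin 3) - (z 2 / ‖z‖ ^ 3) • innerSL ℝ z) z := by
  have hn : ‖z‖ ≠ 0 := norm_ne_zero_iff.mpr hz
  have hp : HasFDerivAt (fun y : E3 => y 2) (EuclideanSpace.proj (𝕜 := ℝ) (2 : Fin 3)) z :=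
    (EuclideanSpace.proj (𝕜 := ℝ) (2 : Fin 3)).hasFDerivAt
  have hdiv := hp.fun_mul
    ((hasDerivAt_inv hn).comp_hasFDerivAt z (hasFDerivAt_norm_of_ne_zero hz))
  refine HasFDerivAt.congr_fderiv (f := Lam) hdiv ?_
  ext v
  simp
  field_simp
  ring

/-- The inner product of `ξ - η` with `η_h^⊥`. -/
lemma inner_sub_hperp (ξ η : E3) : ⟪ξ - η, hperp η⟫ = η 0 * ξ 1 - η 1 * ξ 0 := by
  simp [hperp, Ev3, PiLp.inner_apply, Fin.sum_univ_three]
  ring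

/-- The inner product of `σ̄(ξ,η)` with `(ξ_h - η_h)^⊥`. -/
lemma inner_sigmaBar_hperp_sub (ξ η : E3) :
    ⟪sigmaBar ξ η, hperp (ξ - η)⟫ = -((ξ - η) 2 * (η 0 * ξ 1 - η 1 * ξ 0)) := by
  simp [sigmaBar, hpart, hperp, Ev3, PiLp.inner_apply, Fin.sum_univ_three]
  ring

/-- **The rotation vector field applied to the phase (Lemma 6.1 and Remark A.2).**
For `ξ ≠ η`, the directional derivative of `η' ↦ Λ(ξ−η')` at `η` in the direction
`η_h^⊥ = (−η₂,η₁,0)` equals `−σ̄(ξ,η)·(ξ_h−η_h)^⊥/‖ξ−η‖³`, which moreover equals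
`Λ(ξ−η)·(η₁ξ₂−η₂ξ₁)/‖ξ−η‖²`. -/
theorem stmt_8 (ξ η : E3) (hne : ξ ≠ η) :
    DifferentiableAt ℝ (fun η' : E3 => Lam (ξ - η')) η ∧
    fderiv ℝ (fun η' : E3 => Lam (ξ - η')) η (hperp η)
      = -⟪sigmaBar ξ η, hperp (ξ - η)⟫ / ‖ξ - η‖ ^ 3 ∧
    fderiv ℝ (fun η' : E3 => Lam (ξ - η')) η (hperp η)
      = Lam (ξ - η) * (η 0 * ξ 1 - η 1 * ξ 0) / ‖ξ - η‖ ^ 2 := by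
  have hz : ξ - η ≠ 0 := sub_ne_zero.mpr hne
  have hn : ‖ξ - η‖ ≠ 0 := norm_ne_zero_iff.mpr hz
  have hd := (hasFDerivAt_Lam hz).comp η ((hasFDerivAt_id η).const_sub ξ)
  have hval : fderiv ℝ (fun η' : E3 => Lam (ξ - η')) η (hperp η)
      = (ξ - η) 2 * (η 0 * ξ 1 - η 1 * ξ 0) / ‖ξ - η‖ ^ 3 := by
    have hvert : hperp η 2 = 0 := by simp [hperp, Ev3]
    have hfd : fderiv ℝ (fun η' : E3 => Lam (ξ - η')) η = _ := hd.fderiv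
    rw [hfd, ← inner_sub_hperp]
    simp only [ContinuousLinearMap.comp_apply, neg_apply,
      ContinuousLinearMap.id_apply, map_neg, sub_apply,
      smul_apply, innerSL_apply_apply, PiLp.proj_apply, hvert,
      smul_eq_mul]
    ring
  refine ⟨hd.differentiableAt, ?_, ?_⟩
  · rw [hval, inner_sigmaBar_hperp_sub, neg_neg]
  · rw [hval, Lam]
    field_simp
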